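/- The map φ : (SO(3) ⋉ ℝ³) × TS² → TS², φ((R, r), (q, v)) = (Rq, Rv + r × Rq), is a group action: φ((I, 0), (q, v)) = (q, v), and for all R₁, R₂ ∈ SO(3), r₁, r₂ ∈ ℝ³ and all (q, v) ∈ TS² one has φ((R₁R₂, r₁ + R₁r₂), (q, v)) = φ((R₁, r₁), φ((R₂, r₂), (q, v))), where (R₁, r₁)·(R₂, r₂) := (R₁R₂, r₁ + R₁r₂) is the semidirect product (SE(3)) multiplication. -/

import Mathlib

open Matrix

/-- The map `φ((R, r), (q, v)) = (Rq, Rv + r × Rq)`. -/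
def phiSE3 (R : Matrix (Fin 3) (Fin 3) ℝ) (r : Fin 3 → ℝ)
    (qv : (Fin 3 → ℝ) × (Fin 3 → ℝ)) : (Fin 3 → ℝ) × (Fin 3 → ℝ) :=
  (R *ᵥ qv.1, R *ᵥ qv.2 + crossProduct r (R *ᵥ qv.1))

/-- The cross product is covariant up to the determinant. -/
theorem transpose_mulVec_crossProduct_mulVec {K : Type*} [CommRing K]
    (A : Matrix (Fin 3) (Fin 3) K) (a b : Fin 3 → K) :
    Aᵀ *ᵥ crossProduct (A *ᵥ a) (A *ᵥ b) = A.det • crossProduct a b := by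
  ext i
  fin_cases i <;>
    simp [cross_apply, mulVec, dotProduct, Fin.sum_univ_three, det_fin_three] <;> ring

/-- Rotations preserve the cross product. -/
theorem mulVec_crossProduct_of_rotation {K : Type*} [CommRing K]
    {R : Matrix (Fin 3) (Fin 3) K} (hR : Rᵀ * R = 1) (hdet : R.det = 1) (a b : Fin 3 → K) :
    R *ᵥ crossProduct a b = crossProduct (R *ᵥ a) (R *ᵥ b) := by
  have h := transpose_mulVec_crossProduct_mulVec R a b
  rw [hdet, one_smul] at h
  rw [← h, mulVec_mulVec, mul_eq_one_comm.mp hR, one_mulVec]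

/-- `φ` is a group action of `SE(3) = SO(3) ⋉ ℝ³` on `TS²`: the identity `(I, 0)` acts
trivially, and the action is compatible with the semidirect product multiplication
`(R₁, r₁) · (R₂, r₂) = (R₁R₂, r₁ + R₁r₂)`. -/
theorem phiSE3_is_group_action :
    (∀ q v : Fin 3 → ℝ, q ⬝ᵥ q = 1 → q ⬝ᵥ v = 0 →
        phiSE3 1 0 (q, v) = (q, v)) ∧
    ∀ R₁ R₂ : Matrix (Fin 3) (Fin 3) ℝ, R₁ᵀ * R₁ = 1 → R₁.det = 1 →
      R₂ᵀ * R₂ = 1 → R₂.det = 1 →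
      ∀ r₁ r₂ : Fin 3 → ℝ, ∀ q v : Fin 3 → ℝ, q ⬝ᵥ q = 1 → q ⬝ᵥ v = 0 →
        phiSE3 (R₁ * R₂) (r₁ + R₁ *ᵥ r₂) (q, v) =
          phiSE3 R₁ r₁ (phiSE3 R₂ r₂ (q, v)) := by
  refine ⟨fun q v _ _ => by simp [phiSE3], fun R₁ R₂ h₁ d₁ _ _ r₁ r₂ q v _ _ => ?_⟩
  simp only [phiSE3, mulVec_add, mulVec_crossProduct_of_rotation h₁ d₁, mulVec_mulVec,
    map_add, LinearMap.add_apply]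
  rw [add_assoc, add_comm (crossProduct r₁ _)]
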